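/- For every natural number n, the following identity of polynomials in y and q holds: Σ_{π ∈ Π_n} y^{|π|} q^{cro(π)} = Σ over Motzkin paths P of length n of (Π over up steps of P of y) · (Π over level steps of P starting at height h of (y + [h]_q)) · (Π over down steps of P starting at height h of [h]_q), where [h]_q = 1+q+…+q^{h-1}. -/

import Mathlib

open Finset

inductive Step : Type
  | U | L | D
deriving DecidableEq

instance : Fintype Step :=
  ⟨{Step.U, Step.L, Step.D}, fun x => by cases x <;> simp⟩

/-- The vertical displacement of a step: up = +1, level = 0, down = -1. -/
def Step.val : Step → ℤ
  | .U => 1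
  | .L => 0
  | .D => -1

/-- The partial sum of the step values of the first `i` steps;
this is the height at which step `i` starts. -/
def hsum {n : ℕ} (P : Fin n → Step) (i : ℕ) : ℤ :=
  ∑ j ∈ Finset.univ.filter (fun j : Fin n => (j : ℕ) < i), (P j).val

/-- A Motzkin path: all partial sums nonnegative and total sum 0. -/
abbrev IsMotzkin {n : ℕ} (P : Fin n → Step) : Prop :=
  (∀ i : Fin (n+1), 0 ≤ hsum P (i : ℕ)) ∧ hsum P n = 0

/-- A Motzkin prefix of final height `k`: all partial sums nonnegative, total sum `k`. -/
abbrev IsMPrefix {n : ℕ} (P : Fin n → Step) (k : ℕ) : Prop :=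
  (∀ i : Fin (n+1), 0 ≤ hsum P (i : ℕ)) ∧ hsum P n = (k : ℤ)

/-- `[h]_q = 1 + q + ... + q^(h-1)`. -/
def geo {R : Type*} [CommSemiring R] (q : R) (h : ℤ) : R :=
  ∑ i ∈ Finset.range h.toNat, q ^ i

/-- The Gaussian (q-)binomial coefficient, via the q-Pascal recurrence. -/
def qbinom {R : Type*} [CommSemiring R] (q : R) : ℕ → ℕ → R
  | _, 0 => 1
  | 0, _+1 => 0
  | n+1, k+1 => qbinom q n k + q ^ (k+1) * qbinom q n (k+1)

/-- The binomial coefficient with integer lower argument, zero on negative arguments. -/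
def ch (m : ℕ) (j : ℤ) : ℤ := if 0 ≤ j then m.choose j.toNat else 0

/-- A set partition of `Fin n`, given as the finset of its blocks:
blocks are nonempty and every element lies in exactly one block. -/
abbrev IsPartition {n : ℕ} (P : Finset (Finset (Fin n))) : Prop :=
  (∀ B ∈ P, B.Nonempty) ∧ ∀ x : Fin n, (P.filter (fun B => x ∈ B)).card = 1

/-- `(a, b)` is an arc of the partition `P`: `a < b`, they lie in a common block,
and no element of that block is strictly between them. -/
abbrev IsArc {n : ℕ} (P : Finset (Finset (Fin n))) (a b : Fin n) : Prop :=
  a < b ∧ ∃ B ∈ P, a ∈ B ∧ b ∈ B ∧ ∀ c ∈ B, ¬(a < c ∧ c < b)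

/-- The number of crossings of a set partition: pairs of arcs `(i,j)`, `(k,l)`
with `i < k < j < l`. -/
def croP {n : ℕ} (P : Finset (Finset (Fin n))) : ℕ :=
  (Finset.univ.filter (fun x : (Fin n × Fin n) × (Fin n × Fin n) =>
    IsArc P x.1.1 x.1.2 ∧ IsArc P x.2.1 x.2.2 ∧
    x.1.1 < x.2.1 ∧ x.2.1 < x.1.2 ∧ x.1.2 < x.2.2)).card

/-- The modified crossing number `cro*`: crossings, plus pairs of a block
maximum `m` and an arc `(k,l)` with `k < m < l`. -/
def croStar {n : ℕ} (P : Finset (Finset (Fin n))) : ℕ :=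
  croP P +
  (Finset.univ.filter (fun x : Fin n × Fin n × Fin n =>
    (∃ B ∈ P, x.1 ∈ B ∧ ∀ y ∈ B, y ≤ x.1) ∧
    IsArc P x.2.1 x.2.2 ∧ x.2.1 < x.1 ∧ x.1 < x.2.2)).card


namespace S5

abbrev Good (n : ℕ) (A : Finset (ℕ × ℕ)) : Prop :=
  (∀ x ∈ A, x.1 < x.2 ∧ x.2 < n) ∧ (∀ x ∈ A, ∀ y ∈ A, x.1 = y.1 → x = y) ∧
    (∀ x ∈ A, ∀ y ∈ A, x.2 = y.2 → x = y)

def AS (n : ℕ) : Finset (Finset (ℕ × ℕ)) :=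
  ((range n ×ˢ range n).powerset).filter (fun A => Good n A)

lemma mem_AS {n : ℕ} {A : Finset (ℕ × ℕ)} : A ∈ AS n ↔ Good n A := by
  unfold AS
  rw [mem_filter, mem_powerset]
  constructor
  · exact fun h => h.2
  · intro h
    refine ⟨fun x hx => ?_, h⟩
    have := h.1 x hx
    rw [mem_product, mem_range, mem_range]
    omega

def op (n : ℕ) (A : Finset (ℕ × ℕ)) : Finset ℕ := range n \ A.image Prod.fst
def blk (n : ℕ) (A : Finset (ℕ × ℕ)) : ℕ := (range n \ A.image Prod.snd).card
def cov (A : Finset (ℕ × ℕ)) (m : ℕ) : ℕ := ∑ x ∈ A, if x.1 < m ∧ m < x.2 then 1 else 0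
def cro (A : Finset (ℕ × ℕ)) : ℕ :=
  ∑ x ∈ A, ∑ y ∈ A, if x.1 < y.1 ∧ y.1 < x.2 ∧ x.2 < y.2 then 1 else 0

lemma mem_op {n : ℕ} {A : Finset (ℕ × ℕ)} {i : ℕ} :
    i ∈ op n A ↔ i < n ∧ ∀ x ∈ A, x.1 ≠ i := by
  unfold op
  rw [mem_sdiff, mem_range, mem_image]
  push Not
  rfl

lemma AS_succ {R : Type*} [CommRing R] (n : ℕ) (f : Finset (ℕ × ℕ) → R) :
    ∑ A ∈ AS (n+1), f A = ∑ A ∈ AS n, (f A + ∑ i ∈ op n A, f (insert (i, n) A)) := by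
  classical
  rw [sum_add_distrib, ← sum_filter_add_sum_filter_not (AS (n+1)) (fun A => ∀ x ∈ A, x.2 ≠ n)]
  congr 1
  · apply sum_congr _ (fun _ _ => rfl)
    ext A
    rw [mem_filter, mem_AS, mem_AS]
    constructor
    · rintro ⟨h, h'⟩
      refine ⟨fun x hx => ?_, h.2⟩
      have := h.1 x hx
      have := h' x hx
      omega
    · rintro h
      refine ⟨⟨fun x hx => ?_, h.2⟩, fun x hx => ?_⟩ <;>
      · have := h.1 x hx
        omega
  · rw [sum_sigma']
    symm
    refine sum_bij (fun x _ => insert (x.2, n) x.1) ?_ ?_ ?_ ?_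
    · rintro ⟨A, i⟩ h
      rw [mem_sigma, mem_AS, mem_op] at h
      obtain ⟨hA, hi, hi'⟩ := h
      simp only at hA hi hi'
      rw [mem_filter, mem_AS]
      refine ⟨⟨?_, ?_, ?_⟩, ?_⟩
      · intro x hx
        rw [mem_insert] at hx
        rcases hx with rfl | hx
        · simp only; omega
        · have := hA.1 x hx
          omega
      · intro x hx y hy hxy
        rw [mem_insert] at hx hy
        rcases hx with rfl | hx <;> rcases hy with rfl | hy
        · rfl
        · exact absurd hxy.symm (hi' y hy)
        · exact absurd hxy (hi' x hx)
        · exact hA.2.1 x hx y hy hxy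
      · intro x hx y hy hxy
        rw [mem_insert] at hx hy
        rcases hx with rfl | hx <;> rcases hy with rfl | hy
        · rfl
        · have := hA.1 y hy
          simp only at hxy; omega
        · have := hA.1 x hx
          simp only at hxy; omega
        · exact hA.2.2 x hx y hy hxy
      · push Not
        exact ⟨(i, n), mem_insert_self _ _, rfl⟩
    · rintro ⟨A, i⟩ h ⟨B, j⟩ h' he
      rw [mem_sigma, mem_AS, mem_op] at h h'
      simp only at h h' he
      have hA : (i, n) ∉ A := fun hh => by have := h.1.1 _ hh; simp at this
      have hA' : (j, n) ∉ A := fun hh => by have := h.1.1 _ hh; simp at this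
      have hB : (j, n) ∉ B := fun hh => by have := h'.1.1 _ hh; simp at this
      have hij : i = j := by
        have : (j, n) ∈ insert (i, n) A := by rw [he]; exact mem_insert_self _ _
        rw [mem_insert] at this
        rcases this with h1 | h1
        · simpa using h1.symm
        · exact absurd h1 hA'
      subst hij
      have : A = B := by
        rw [← erase_insert hA, he, erase_insert hB]
      rw [this]
    · intro A h
      rw [mem_filter, mem_AS] at h
      obtain ⟨hA, h⟩ := h
      push Not at h
      obtain ⟨⟨i, m⟩, hx, hm⟩ := h
      simp only at hm
      subst hm
      refine ⟨⟨A.erase (i, m), i⟩, ?_, insert_erase hx⟩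
      rw [mem_sigma, mem_AS, mem_op]
      simp only
      refine ⟨⟨?_, ?_, ?_⟩, ?_, ?_⟩
      · intro x hx'
        rw [mem_erase] at hx'
        have h1 := hA.1 x hx'.2
        have h2 : x.2 ≠ m := fun h => hx'.1 (hA.2.2 x hx'.2 _ hx h)
        omega
      · exact fun x hx y hy => hA.2.1 x (mem_of_mem_erase hx) y (mem_of_mem_erase hy)
      · exact fun x hx y hy => hA.2.2 x (mem_of_mem_erase hx) y (mem_of_mem_erase hy)
      · exact (hA.1 _ hx).1
      · intro x hx' he
        rw [mem_erase] at hx'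
        exact hx'.1 (hA.2.1 x hx'.2 _ hx he)
    · intros; rfl

def w {R : Type*} [CommRing R] (y q : R) (n : ℕ) (A : Finset (ℕ × ℕ)) (T : Finset ℕ) : R :=
  y ^ blk n A * q ^ (cro A + ∑ m ∈ T, cov A m)

def Phi {R : Type*} [CommRing R] (y q : R) (n : ℕ) (g : ℤ → R) : R :=
  ∑ A ∈ AS n, ∑ T ∈ (op n A).powerset, w y q n A T * g T.card

def Lop {R : Type*} [CommRing R] (y q : R) (g : ℤ → R) (h : ℤ) : R :=
  y * g (h + 1) + (y + geo q h) * g h + geo q h * g (h - 1)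

lemma geo_sum {R : Type*} [CommRing R] (q : R) (U : Finset ℕ) :
    ∑ i ∈ U, q ^ (U.filter (fun m => i < m)).card = geo q U.card := by
  unfold geo
  rw [Int.toNat_natCast]
  induction U using Finset.induction_on_min with
  | empty => simp
  | insert a s h ih =>
    have ha : a ∉ s := fun h' => lt_irrefl _ (h a h')
    rw [sum_insert ha, card_insert_of_notMem ha, sum_range_succ, ← ih, add_comm]
    congr 1
    · apply sum_congr rfl
      intro i hi
      rw [filter_insert, if_neg (not_lt.mpr (h i hi).le)]
    · rw [filter_insert, if_neg (lt_irrefl _), filter_true_of_mem h]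

lemma op_succ {n : ℕ} {A : Finset (ℕ × ℕ)} (hA : Good n A) : op (n+1) A = insert n (op n A) := by
  ext i
  rw [mem_insert, mem_op, mem_op]
  constructor
  · rintro ⟨h, h'⟩
    by_cases hi : i = n
    · exact Or.inl hi
    · exact Or.inr ⟨by omega, h'⟩
  · rintro (rfl | h)
    · refine ⟨by omega, fun x hx => ?_⟩
      have := hA.1 x hx
      omega
    · exact ⟨by omega, h.2⟩

lemma op_succ' {n i : ℕ} {A : Finset (ℕ × ℕ)} (hA : Good n A) (hi : i ∈ op n A) :
    op (n+1) (insert (i, n) A) = insert n ((op n A).erase i) := by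
  ext j
  rw [mem_op] at hi
  rw [mem_insert, mem_erase, mem_op, mem_op]
  simp only [mem_insert, forall_eq_or_imp]
  constructor
  · rintro ⟨h, h', h''⟩
    by_cases hi : j = n
    · exact Or.inl hi
    · exact Or.inr ⟨h'.symm, by omega, h''⟩
  · rintro (rfl | h)
    · refine ⟨by omega, by omega, fun x hx => ?_⟩
      have := hA.1 x hx
      omega
    · exact ⟨by omega, h.1.symm, h.2.2⟩

lemma blk_succ {n : ℕ} {A : Finset (ℕ × ℕ)} (hA : Good n A) : blk (n+1) A = blk n A + 1 := by
  unfold blk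
  have hn : n ∉ A.image Prod.snd := by
    rw [mem_image]
    rintro ⟨x, hx, h⟩
    have := hA.1 x hx
    omega
  rw [range_add_one, insert_sdiff_of_notMem _ hn, card_insert_of_notMem (by simp)]

lemma blk_succ' {n : ℕ} {A : Finset (ℕ × ℕ)} (i : ℕ) :
    blk (n+1) (insert (i, n) A) = blk n A := by
  unfold blk
  congr 1
  ext j
  simp only [image_insert, mem_sdiff, mem_range, mem_insert]
  push Not
  constructor
  · rintro ⟨h, h', h''⟩
    exact ⟨by omega, h''⟩
  · rintro ⟨h, h'⟩
    exact ⟨by omega, by omega, h'⟩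

lemma cov_n {n : ℕ} {A : Finset (ℕ × ℕ)} (hA : Good n A) : cov A n = 0 := by
  unfold cov
  apply sum_eq_zero
  intro x hx
  have := hA.1 x hx
  rw [if_neg (by omega)]

lemma notMem_n {n i : ℕ} {A : Finset (ℕ × ℕ)} (hA : Good n A) : (i, n) ∉ A := fun h => by
  have := hA.1 _ h
  simp at this

lemma cov_ins {n i m : ℕ} {A : Finset (ℕ × ℕ)} (hA : Good n A) (hm : m < n) :
    cov (insert (i, n) A) m = cov A m + if i < m then 1 else 0 := by
  unfold cov
  rw [sum_insert (notMem_n hA), add_comm]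
  simp [hm]

lemma cov_ins_n {n i : ℕ} {A : Finset (ℕ × ℕ)} (hA : Good n A) :
    cov (insert (i, n) A) n = 0 := by
  have := cov_n hA
  unfold cov at *
  rw [sum_insert (notMem_n hA), this]
  simp

lemma cro_ins {n i : ℕ} {A : Finset (ℕ × ℕ)} (hA : Good n A) :
    cro (insert (i, n) A) = cro A + cov A i := by
  unfold cro cov
  rw [sum_insert (notMem_n hA), sum_eq_zero, zero_add, ← sum_add_distrib]
  · apply sum_congr rfl
    intro x hx
    rw [sum_insert (notMem_n hA), add_comm]
    have := hA.1 x hx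
    simp [this.2]
  · intro x hx
    rw [mem_insert] at hx
    rcases hx with rfl | hx
    · simp
    · have := hA.1 x hx
      rw [if_neg]
      simp only
      omega

lemma swap {R : Type*} [CommRing R] (s : Finset ℕ) (F : ℕ → Finset ℕ → R) :
    ∑ i ∈ s, ∑ T ∈ (s.erase i).powerset, F i T = ∑ U ∈ s.powerset, ∑ i ∈ U, F i (U.erase i) := by
  rw [sum_sigma', sum_sigma']
  refine sum_bij' (fun x _ => ⟨insert x.1 x.2, x.1⟩) (fun x _ => ⟨x.2, x.1.erase x.2⟩) ?_ ?_ ?_ ?_ ?_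
  · rintro ⟨i, T⟩ h
    simp only [mem_sigma, mem_powerset] at h ⊢
    exact ⟨insert_subset h.1 (h.2.trans (erase_subset _ _)), mem_insert_self _ _⟩
  · rintro ⟨U, i⟩ h
    simp only [mem_sigma, mem_powerset] at h ⊢
    exact ⟨h.1 h.2, erase_subset_erase _ h.1⟩
  · rintro ⟨i, T⟩ h
    simp only [mem_sigma, mem_powerset] at h ⊢
    have : i ∉ T := fun hh => by simpa using h.2 hh
    rw [erase_insert this]
  · rintro ⟨U, i⟩ h
    simp only [mem_sigma, mem_powerset] at h ⊢
    rw [insert_erase h.2]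
  · rintro ⟨i, T⟩ h
    simp only [mem_sigma, mem_powerset] at h ⊢
    have : i ∉ T := fun hh => by simpa using h.2 hh
    rw [erase_insert this]

lemma Phi_succ {R : Type*} [CommRing R] (y q : R) (n : ℕ) (g : ℤ → R) :
    Phi y q (n+1) g = Phi y q n (Lop y q g) := by
  unfold Phi
  rw [AS_succ]
  apply sum_congr rfl
  intro A hA
  rw [mem_AS] at hA
  have hn : n ∉ op n A := by rw [mem_op]; omega
  have h1 : ∑ T ∈ (op (n+1) A).powerset, w y q (n+1) A T * g T.card
      = ∑ T ∈ (op n A).powerset, w y q n A T * (y * g T.card + y * g (T.card + 1)) := by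
    rw [op_succ hA, sum_powerset_insert hn, ← sum_add_distrib]
    apply sum_congr rfl
    intro T hT
    have hnT : n ∉ T := fun h => hn (mem_powerset.mp hT h)
    unfold w
    rw [blk_succ hA, sum_insert hnT, cov_n hA, card_insert_of_notMem hnT]
    push_cast
    ring
  have h2 : ∑ i ∈ op n A, ∑ T ∈ (op (n+1) (insert (i, n) A)).powerset,
        w y q (n+1) (insert (i, n) A) T * g T.card
      = ∑ i ∈ op n A, ∑ T ∈ ((op n A).erase i).powerset,
        w y q n A (insert i T) * q ^ (T.filter (fun m => i < m)).card *
          (g T.card + g (T.card + 1)) := by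
    apply sum_congr rfl
    intro i hi
    have hn' : n ∉ (op n A).erase i := fun h => hn (mem_of_mem_erase h)
    rw [op_succ' hA hi, sum_powerset_insert hn', ← sum_add_distrib]
    apply sum_congr rfl
    intro T hT
    rw [mem_powerset] at hT
    have hnT : n ∉ T := fun h => hn' (hT h)
    have hiT : i ∉ T := fun h => by simpa using hT h
    have hs : ∑ m ∈ T, cov (insert (i, n) A) m
        = ∑ m ∈ T, cov A m + (T.filter (fun m => i < m)).card := by
      rw [card_filter, ← sum_add_distrib]
      apply sum_congr rfl
      intro m hm
      exact cov_ins hA (mem_op.mp (mem_of_mem_erase (hT hm))).1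
    unfold w
    rw [blk_succ', cro_ins hA, sum_insert hnT, sum_insert hiT, cov_ins_n hA, hs,
      card_insert_of_notMem hnT]
    push_cast
    ring
  rw [h1, h2, swap, ← sum_add_distrib]
  apply sum_congr rfl
  intro U hU
  have h3 : ∑ i ∈ U, w y q n A (insert i (U.erase i)) *
        q ^ ((U.erase i).filter (fun m => i < m)).card *
          (g (U.erase i).card + g ((U.erase i).card + 1))
      = ∑ i ∈ U, w y q n A U * (g (U.card - 1) + g U.card) *
        q ^ (U.filter (fun m => i < m)).card := by
    apply sum_congr rfl
    intro i hi
    have hc : (((U.erase i).card : ℕ) : ℤ) = U.card - 1 := by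
      have := card_erase_add_one hi
      push_cast [← this]
      ring
    have hf : (U.erase i).filter (fun m => i < m) = U.filter (fun m => i < m) := by
      ext m
      simp only [mem_filter, mem_erase]
      constructor
      · rintro ⟨h, h'⟩; exact ⟨h.2, h'⟩
      · rintro ⟨h, h'⟩; exact ⟨⟨by omega, h⟩, h'⟩
    rw [insert_erase hi, hc, hf, sub_add_cancel]
    ring
  rw [h3, ← mul_sum, geo_sum]
  unfold Lop
  ring

lemma Phi_zero {R : Type*} [CommRing R] (y q : R) (g : ℤ → R) : Phi y q 0 g = g 0 := by
  have : AS 0 = {∅} := by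
    ext A
    rw [mem_AS, mem_singleton]
    constructor
    · intro h
      rw [eq_empty_iff_forall_notMem]
      intro x hx
      have := h.1 x hx
      omega
    · rintro rfl
      exact ⟨by simp, by simp, by simp⟩
  unfold Phi
  rw [this]
  simp [op, w, blk, cro]

def wt {R : Type*} [CommRing R] (y q : R) : Step → ℤ → R
  | Step.U, _ => y
  | Step.L, h => y + geo q h
  | Step.D, h => geo q h

def Psi {R : Type*} [CommRing R] (y q : R) (n : ℕ) (g : ℤ → R) : R :=
  ∑ M : Fin n → Step, (∏ i : Fin n, wt y q (M i) (hsum M i)) * g (hsum M n)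

lemma hsum_zero {n : ℕ} (M : Fin n → Step) : hsum M 0 = 0 := by
  simp [hsum]

lemma hsum_snoc {n : ℕ} (M : Fin n → Step) (s : Step) (i : ℕ) (hi : i ≤ n) :
    hsum (Fin.snoc M s : Fin (n+1) → Step) i = hsum M i := by
  unfold hsum
  rw [sum_filter, sum_filter, Fin.sum_univ_castSucc]
  simp [hi]

lemma hsum_snoc_last {n : ℕ} (M : Fin n → Step) (s : Step) :
    hsum (Fin.snoc M s : Fin (n+1) → Step) (n+1) = hsum M n + s.val := by
  unfold hsum
  rw [sum_filter, sum_filter, Fin.sum_univ_castSucc]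
  simp only [Fin.snoc_castSucc, Fin.snoc_last, Fin.val_castSucc, Fin.val_last]
  congr 1
  · apply sum_congr rfl
    intro j _
    rw [if_pos (by omega), if_pos (by omega)]
  · simp

lemma hsum_succ {n : ℕ} (M : Fin n → Step) (i : Fin n) :
    hsum M (i+1) = hsum M i + (M i).val := by
  unfold hsum
  have : (univ.filter (fun j : Fin n => (j : ℕ) < i + 1))
      = insert i (univ.filter (fun j : Fin n => (j : ℕ) < i)) := by
    ext j
    simp only [mem_filter, mem_univ, true_and, mem_insert, Fin.ext_iff]
    omega
  rw [this, sum_insert (by simp), add_comm]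

lemma Psi_succ {R : Type*} [CommRing R] (y q : R) (n : ℕ) (g : ℤ → R) :
    Psi y q (n+1) g = Psi y q n (Lop y q g) := by
  unfold Psi
  rw [← (Fin.snocEquiv (fun _ : Fin (n+1) => Step)).sum_comp, Fintype.sum_prod_type_right]
  apply sum_congr rfl
  intro M _
  have h : ∀ s : Step, (∏ i : Fin (n+1), wt y q ((Fin.snoc M s : Fin (n+1) → Step) i)
      (hsum (Fin.snoc M s : Fin (n+1) → Step) i)) * g (hsum (Fin.snoc M s : Fin (n+1) → Step) (n+1))
      = (∏ i : Fin n, wt y q (M i) (hsum M i)) * (wt y q s (hsum M n) * g (hsum M n + s.val)) := by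
    intro s
    rw [Fin.prod_univ_castSucc, hsum_snoc_last, ← mul_assoc]
    simp only [Fin.snoc_castSucc, Fin.snoc_last, Fin.val_castSucc, Fin.val_last]
    rw [hsum_snoc M s n le_rfl]
    congr 2
    apply prod_congr rfl
    intro i _
    rw [hsum_snoc M s i (by omega)]
  have hu : (univ : Finset Step) = {Step.U, Step.L, Step.D} := rfl
  have : ∀ f : Step → R, ∑ s, f s = f Step.U + f Step.L + f Step.D := by
    intro f
    rw [hu, sum_insert (by simp), sum_insert (by simp), sum_singleton]
    ring
  simp only [Fin.snocEquiv_apply]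
  erw [sum_congr rfl (fun s _ => h s)]
  rw [← mul_sum, this]
  simp [Lop, wt, Step.val, sub_eq_add_neg]

lemma Phi_eq_Psi {R : Type*} [CommRing R] (y q : R) (n : ℕ) (g : ℤ → R) :
    Phi y q n g = Psi y q n g := by
  induction n generalizing g with
  | zero =>
    rw [Phi_zero]
    simp [Psi, hsum]
  | succ n ih => rw [Phi_succ, Psi_succ, ih]

lemma Psi_delta {R : Type*} [CommRing R] (y q : R) (n : ℕ) :
    Psi y q n (fun h => if h = 0 then 1 else 0) =
    ∑ M ∈ Finset.univ.filter (fun M : Fin n → Step => IsMotzkin M),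
      ∏ i : Fin n, wt y q (M i) (hsum M i) := by
  unfold Psi
  rw [sum_filter]
  apply sum_congr rfl
  intro M _
  beta_reduce
  by_cases h : IsMotzkin M
  · rw [if_pos h, if_pos h.2, mul_one]
  · rw [if_neg h]
    by_cases h0 : hsum M n = 0
    · have h1 : ¬ ∀ i : Fin (n+1), 0 ≤ hsum M (i : ℕ) := fun h' => h ⟨h', h0⟩
      rw [if_pos h0, mul_one]
      by_contra hne
      apply h1
      have key : ∀ k, k ≤ n → 0 ≤ hsum M k := by
        intro k
        induction k with
        | zero => intro _; rw [hsum_zero]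
        | succ k ih =>
          intro hk
          have hk' := ih (by omega)
          have hs := hsum_succ M ⟨k, hk⟩
          simp only at hs
          rw [hs]
          by_contra hlt
          apply hne
          apply prod_eq_zero (mem_univ (⟨k, hk⟩ : Fin n))
          cases hM : M ⟨k, hk⟩ with
          | U => rw [hM] at hlt; simp only [Step.val] at hlt; omega
          | L => rw [hM] at hlt; simp only [Step.val] at hlt; omega
          | D =>
            rw [hM] at hlt; simp only [Step.val] at hlt
            have : hsum M k = 0 := by omega
            simp [wt, this, geo]
      exact fun i => key i (by omega)
    · rw [if_neg h0, mul_zero]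

lemma Phi_delta {R : Type*} [CommRing R] (y q : R) (n : ℕ) :
    Phi y q n (fun h => if h = 0 then 1 else 0) = ∑ A ∈ AS n, y ^ blk n A * q ^ cro A := by
  unfold Phi
  apply sum_congr rfl
  intro A _
  rw [sum_eq_single ∅]
  · simp [w]
  · intro T _ hT
    beta_reduce
    rw [if_neg, mul_zero]
    simpa using hT
  · simp

open Classical in
noncomputable def root (A : Finset (ℕ × ℕ)) (b : ℕ) : ℕ :=
  if h : ∃ a, a < b ∧ (a, b) ∈ A then root A h.choose else b
termination_by b
decreasing_by exact h.choose_spec.1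

lemma root_arc {n a b : ℕ} {A : Finset (ℕ × ℕ)} (hA : Good n A) (h : (a, b) ∈ A) :
    root A b = root A a := by
  rw [root]
  have hex : ∃ a, a < b ∧ (a, b) ∈ A := ⟨a, (hA.1 _ h).1, h⟩
  rw [dif_pos hex]
  have := hA.2.2 _ hex.choose_spec.2 _ h rfl
  rw [(Prod.mk.inj this).1]

lemma root_none {b : ℕ} {A : Finset (ℕ × ℕ)} (h : ∀ a, (a, b) ∉ A) : root A b = b := by
  rw [root, dif_neg]
  rintro ⟨a, _, h'⟩
  exact h a h'

lemma exists_pred {b : ℕ} {A : Finset (ℕ × ℕ)} (h : root A b ≠ b) : ∃ a, (a, b) ∈ A := by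
  by_contra hh
  push Not at hh
  exact h (root_none hh)

lemma root_le {n : ℕ} {A : Finset (ℕ × ℕ)} (hA : Good n A) (b : ℕ) : root A b ≤ b := by
  induction b using Nat.strong_induction_on with
  | _ b ih =>
    by_cases h : root A b = b
    · exact h.le
    · obtain ⟨a, ha⟩ := exists_pred h
      rw [root_arc hA ha]
      have h1 : a < b := (hA.1 _ ha).1
      exact (ih a h1).trans h1.le

lemma between {n : ℕ} {A : Finset (ℕ × ℕ)} (hA : Good n A) (N : ℕ) :
    ∀ a b c, b + c ≤ N → (a, b) ∈ A → a < c → c < b → root A c = root A b → False := by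
  induction N with
  | zero => intro a b c h _ h1 h2; omega
  | succ N ih =>
    intro a b c h hab h1 h2 he
    have hra := root_arc hA hab
    have hle := root_le hA a
    obtain ⟨c', hc'⟩ := exists_pred (A := A) (b := c) (by omega)
    have hc'c : c' < c := (hA.1 _ hc').1
    have hrc := root_arc hA hc'
    have hne : c' ≠ a := by
      rintro rfl
      have := hA.2.1 _ hc' _ hab rfl
      have := (Prod.mk.inj this).2
      omega
    rcases lt_or_gt_of_ne hne with hlt | hlt
    · exact ih c' c a (by omega) hc' hlt h1 (by omega)
    · exact ih a b c' (by omega) hab hlt (by omega) (by omega)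

lemma part_ex {n : ℕ} {P : Finset (Finset (Fin n))} (hP : IsPartition P) (x : Fin n) :
    ∃ B ∈ P, x ∈ B := by
  obtain ⟨B, hB⟩ := card_eq_one.mp (hP.2 x)
  have : B ∈ P.filter (fun B => x ∈ B) := by rw [hB]; exact mem_singleton_self _
  exact ⟨B, mem_filter.mp this⟩

lemma part_uniq {n : ℕ} {P : Finset (Finset (Fin n))} (hP : IsPartition P) {x : Fin n}
    {B C : Finset (Fin n)} (hB : B ∈ P) (hC : C ∈ P) (hxB : x ∈ B) (hxC : x ∈ C) : B = C := by
  exact card_le_one.mp (hP.2 x).le B (mem_filter.mpr ⟨hB, hxB⟩) C (mem_filter.mpr ⟨hC, hxC⟩)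

def toArcs {n : ℕ} (P : Finset (Finset (Fin n))) : Finset (ℕ × ℕ) :=
  ((univ : Finset (Fin n × Fin n)).filter (fun x => IsArc P x.1 x.2)).image
    (fun x => ((x.1 : ℕ), (x.2 : ℕ)))

lemma mem_toArcs {n : ℕ} {P : Finset (Finset (Fin n))} {x : ℕ × ℕ} :
    x ∈ toArcs P ↔ ∃ i j : Fin n, IsArc P i j ∧ x = ((i : ℕ), (j : ℕ)) := by
  unfold toArcs
  rw [mem_image]
  constructor
  · rintro ⟨⟨i, j⟩, h, rfl⟩
    exact ⟨i, j, (mem_filter.mp h).2, rfl⟩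
  · rintro ⟨i, j, h, rfl⟩
    exact ⟨(i, j), mem_filter.mpr ⟨mem_univ _, h⟩, rfl⟩

lemma mem_toArcs' {n : ℕ} {P : Finset (Finset (Fin n))} {i j : Fin n} :
    ((i : ℕ), (j : ℕ)) ∈ toArcs P ↔ IsArc P i j := by
  rw [mem_toArcs]
  constructor
  · rintro ⟨i', j', h, he⟩
    have h1 := Fin.ext (Prod.mk.inj he).1
    have h2 := Fin.ext (Prod.mk.inj he).2
    rw [h1, h2]; exact h
  · exact fun h => ⟨i, j, h, rfl⟩

lemma good_toArcs {n : ℕ} {P : Finset (Finset (Fin n))} (hP : IsPartition P) :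
    Good n (toArcs P) := by
  refine ⟨?_, ?_, ?_⟩
  · intro x hx
    obtain ⟨i, j, h, rfl⟩ := mem_toArcs.mp hx
    exact ⟨h.1, j.2⟩
  · intro x hx y hy hxy
    obtain ⟨i, j, ⟨h, B, hB, hiB, hjB, hB'⟩, rfl⟩ := mem_toArcs.mp hx
    obtain ⟨i', j', ⟨h', C, hC, hiC, hjC, hC'⟩, rfl⟩ := mem_toArcs.mp hy
    obtain rfl : i = i' := Fin.ext hxy
    obtain rfl := part_uniq hP hB hC hiB hiC
    rcases lt_trichotomy j j' with hl | rfl | hl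
    · exact absurd ⟨h, hl⟩ (hC' j hjB)
    · rfl
    · exact absurd ⟨h', hl⟩ (hB' j' hjC)
  · intro x hx y hy hxy
    obtain ⟨i, j, ⟨h, B, hB, hiB, hjB, hB'⟩, rfl⟩ := mem_toArcs.mp hx
    obtain ⟨i', j', ⟨h', C, hC, hiC, hjC, hC'⟩, rfl⟩ := mem_toArcs.mp hy
    obtain rfl : j = j' := Fin.ext hxy
    obtain rfl := part_uniq hP hB hC hjB hjC
    rcases lt_trichotomy i i' with hl | rfl | hl
    · exact absurd ⟨hl, h'⟩ (hB' i' hiC)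
    · rfl
    · exact absurd ⟨hl, h⟩ (hC' i hiB)

lemma exists_arc {n : ℕ} {P : Finset (Finset (Fin n))}
    {B : Finset (Fin n)} (hB : B ∈ P) {x y : Fin n} (hx : x ∈ B) (hy : y ∈ B) (h : y < x) :
    ∃ a ∈ B, IsArc P a x := by
  have hne : (B.filter (fun z => z < x)).Nonempty := ⟨y, mem_filter.mpr ⟨hy, h⟩⟩
  have hm := mem_filter.mp (max'_mem _ hne)
  refine ⟨_, hm.1, hm.2, B, hB, hm.1, hx, ?_⟩
  rintro c hc ⟨h1, h2⟩
  exact absurd (le_max' _ c (mem_filter.mpr ⟨hc, h2⟩)) (not_le.mpr h1)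

lemma root_spec {n : ℕ} {P : Finset (Finset (Fin n))} (hP : IsPartition P)
    {B : Finset (Fin n)} (hB : B ∈ P) (N : ℕ) : ∀ x ∈ B, (x : ℕ) < N →
    ∃ r ∈ B, (r : ℕ) = root (toArcs P) x ∧ ∀ y ∈ B, r ≤ y := by
  induction N with
  | zero => intro x _ h; omega
  | succ N ih =>
    intro x hx hN
    by_cases h : ∃ y ∈ B, y < x
    · obtain ⟨y, hy, hyx⟩ := h
      obtain ⟨a, haB, ha⟩ := exists_arc hB hx hy hyx
      have hlt : (a : ℕ) < x := ha.1
      rw [root_arc (good_toArcs hP) (mem_toArcs'.mpr ha)]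
      exact ih a haB (by omega)
    · push Not at h
      refine ⟨x, hx, ?_, h⟩
      rw [root_none]
      intro a ha
      obtain ⟨i, j, ⟨h1, C, hC, hiC, hjC, _⟩, he⟩ := mem_toArcs.mp ha
      obtain rfl : x = j := Fin.ext (Prod.mk.inj he).2
      obtain rfl := part_uniq hP hB hC hx hjC
      exact absurd h1 (not_lt.mpr (h i hiC))

noncomputable def toPart (n : ℕ) (A : Finset (ℕ × ℕ)) : Finset (Finset (Fin n)) :=
  univ.image (fun x : Fin n => univ.filter (fun y : Fin n => root A y = root A x))

lemma mem_toPart {n : ℕ} {A : Finset (ℕ × ℕ)} {B : Finset (Fin n)} :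
    B ∈ toPart n A ↔ ∃ x : Fin n, B = univ.filter (fun y : Fin n => root A y = root A x) := by
  unfold toPart
  simp only [mem_image, mem_univ, true_and, eq_comm]

lemma part_toPart (n : ℕ) (A : Finset (ℕ × ℕ)) : IsPartition (toPart n A) := by
  refine ⟨?_, ?_⟩
  · intro B hB
    obtain ⟨x, rfl⟩ := mem_toPart.mp hB
    exact ⟨x, by simp⟩
  · intro x
    rw [card_eq_one]
    refine ⟨univ.filter (fun y : Fin n => root A y = root A x), ?_⟩
    ext B
    rw [mem_filter, mem_singleton, mem_toPart]
    constructor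
    · rintro ⟨⟨z, rfl⟩, h⟩
      rw [mem_filter] at h
      rw [h.2]
    · rintro rfl
      exact ⟨⟨x, rfl⟩, by simp⟩

lemma toPart_toArcs {n : ℕ} {P : Finset (Finset (Fin n))} (hP : IsPartition P) :
    toPart n (toArcs P) = P := by
  have key : ∀ B ∈ P, ∀ x ∈ B,
      univ.filter (fun y : Fin n => root (toArcs P) y = root (toArcs P) x) = B := by
    intro B hB x hx
    obtain ⟨r, hr, hrx, hrm⟩ := root_spec hP hB n x hx x.2
    ext y
    rw [mem_filter]
    obtain ⟨C, hC, hy⟩ := part_ex hP y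
    obtain ⟨s, hs, hsy, hsm⟩ := root_spec hP hC n y hy y.2
    constructor
    · rintro ⟨_, h⟩
      obtain rfl : r = s := Fin.ext (by omega)
      obtain rfl := part_uniq hP hB hC hr hs
      exact hy
    · intro h
      obtain rfl := part_uniq hP hB hC h hy
      have : r = s := le_antisymm (hrm s hs) (hsm r hr)
      subst this
      exact ⟨mem_univ _, by omega⟩
  ext B
  rw [mem_toPart]
  constructor
  · rintro ⟨x, rfl⟩
    obtain ⟨C, hC, hx⟩ := part_ex hP x
    rw [key C hC x hx]
    exact hC
  · intro hB
    obtain ⟨x, hx⟩ := hP.1 B hB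
    exact ⟨x, (key B hB x hx).symm⟩

lemma toArcs_toPart {n : ℕ} {A : Finset (ℕ × ℕ)} (hA : Good n A) :
    toArcs (toPart n A) = A := by
  ext ⟨a, b⟩
  rw [mem_toArcs]
  constructor
  · rintro ⟨i, j, ⟨hij, B, hB, hi, hj, hc⟩, he⟩
    obtain ⟨rfl, rfl⟩ := Prod.mk.inj he
    obtain ⟨x, rfl⟩ := mem_toPart.mp hB
    simp only [mem_filter, mem_univ, true_and] at hi hj hc
    have hij' : (i : ℕ) < j := hij
    have hle := root_le hA i
    obtain ⟨a, ha⟩ := exists_pred (A := A) (b := j) (by omega)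
    have haj : a < j := (hA.1 _ ha).1
    have hr := root_arc hA ha
    rcases lt_trichotomy a i with h | h | h
    · exact (between hA _ a j i le_rfl ha h hij' (by omega)).elim
    · rw [← h]; exact ha
    · have hj2 := j.2
      exact absurd ⟨Fin.mk_lt_mk.mpr h, Fin.mk_lt_mk.mpr haj⟩
        (hc ⟨a, by omega⟩ (by simp only; omega))
  · intro h
    have h1 := hA.1 _ h
    simp only at h1
    refine ⟨⟨a, by omega⟩, ⟨b, h1.2⟩, ⟨h1.1, _, mem_toPart.mpr ⟨⟨b, h1.2⟩, rfl⟩, ?_, ?_, ?_⟩, rfl⟩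
    · simp [root_arc hA h]
    · simp
    · rintro c hc ⟨hc1, hc2⟩
      simp only [mem_filter, mem_univ, true_and] at hc
      exact between hA _ a b c le_rfl h hc1 hc2 hc

lemma cro_toArcs {n : ℕ} (P : Finset (Finset (Fin n))) : cro (toArcs P) = croP P := by
  have : cro (toArcs P) = ((toArcs P ×ˢ toArcs P).filter
      (fun z => z.1.1 < z.2.1 ∧ z.2.1 < z.1.2 ∧ z.1.2 < z.2.2)).card := by
    rw [card_filter, sum_product]
    rfl
  rw [this]
  unfold croP
  symm
  refine card_bij (fun z _ => (((z.1.1 : ℕ), (z.1.2 : ℕ)), ((z.2.1 : ℕ), (z.2.2 : ℕ)))) ?_ ?_ ?_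
  · rintro ⟨⟨i, j⟩, ⟨k, l⟩⟩ h
    obtain ⟨-, h1, h2, h3⟩ := mem_filter.mp h
    exact mem_filter.mpr ⟨mem_product.mpr ⟨mem_toArcs'.mpr h1, mem_toArcs'.mpr h2⟩, h3⟩
  · rintro ⟨⟨i, j⟩, ⟨k, l⟩⟩ _ ⟨⟨i', j'⟩, ⟨k', l'⟩⟩ _ h
    simpa [Fin.ext_iff] using h
  · rintro ⟨x, y⟩ h
    obtain ⟨h1, h2⟩ := mem_filter.mp h
    obtain ⟨hx, hy⟩ := mem_product.mp h1
    obtain ⟨i, j, h3, rfl⟩ := mem_toArcs.mp hx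
    obtain ⟨k, l, h4, rfl⟩ := mem_toArcs.mp hy
    exact ⟨((i, j), (k, l)), mem_filter.mpr ⟨mem_univ _, h3, h4, h2⟩, rfl⟩

lemma blk_toArcs {n : ℕ} {P : Finset (Finset (Fin n))} (hP : IsPartition P) :
    blk n (toArcs P) = P.card := by
  unfold blk
  symm
  refine card_bij (fun B hB => ((B.min' (hP.1 B hB) : Fin n) : ℕ)) ?_ ?_ ?_
  · intro B hB
    rw [mem_sdiff, mem_range, mem_image]
    refine ⟨Fin.is_lt _, ?_⟩
    rintro ⟨x, hx, he⟩
    obtain ⟨i, j, ⟨h, C, hC, hiC, hjC, _⟩, rfl⟩ := mem_toArcs.mp hx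
    have hj : j = B.min' (hP.1 B hB) := Fin.ext he
    have hjB : j ∈ B := hj ▸ min'_mem _ _
    obtain rfl := part_uniq hP hB hC hjB hjC
    rw [hj] at h
    exact absurd (min'_le _ i hiC) (not_le.mpr h)
  · intro B hB C hC h
    have h := Fin.ext h
    have h1 := min'_mem B (hP.1 B hB)
    rw [h] at h1
    exact part_uniq hP hB hC h1 (min'_mem C (hP.1 C hC))
  · intro x hx
    rw [mem_sdiff, mem_range, mem_image] at hx
    obtain ⟨hn, hx⟩ := hx
    obtain ⟨B, hB, hxB⟩ := part_ex hP ⟨x, hn⟩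
    refine ⟨B, hB, ?_⟩
    by_contra hne
    have hlt : B.min' (hP.1 B hB) < ⟨x, hn⟩ :=
      lt_of_le_of_ne (min'_le _ _ hxB) (fun h => hne (by rw [h]))
    obtain ⟨a, _, ha⟩ := exists_arc hB hxB (min'_mem _ _) hlt
    exact hx ⟨_, mem_toArcs'.mpr ha, rfl⟩

lemma main {R : Type*} [CommRing R] (y q : R) (n : ℕ) :
    ∑ P ∈ Finset.univ.filter (fun P : Finset (Finset (Fin n)) => IsPartition P),
        y ^ P.card * q ^ croP P = ∑ A ∈ AS n, y ^ blk n A * q ^ cro A := by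
  refine sum_bij' (fun P _ => toArcs P) (fun A _ => toPart n A) ?_ ?_ ?_ ?_ ?_
  · intro P hP
    exact mem_AS.mpr (good_toArcs (mem_filter.mp hP).2)
  · intro A _
    exact mem_filter.mpr ⟨mem_univ _, part_toPart n A⟩
  · intro P hP
    exact toPart_toArcs (mem_filter.mp hP).2
  · intro A hA
    exact toArcs_toPart (mem_AS.mp hA)
  · intro P hP
    rw [blk_toArcs (mem_filter.mp hP).2, cro_toArcs]

end S5

open MvPolynomial in
/-- The block/crossing generating function of set partitions equals the weighted
count of Motzkin paths with up weight `y`, level weight `y + [h]_q`, down weight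
`[h]_q`.  Here `y = X 0` and `q = X 1`. -/
theorem stmt5 (n : ℕ) :
    ∑ P ∈ Finset.univ.filter (fun P : Finset (Finset (Fin n)) => IsPartition P),
        (X 0 : MvPolynomial (Fin 2) ℤ) ^ P.card * (X 1) ^ croP P
    = ∑ M ∈ Finset.univ.filter (fun M : Fin n → Step => IsMotzkin M),
        ∏ i : Fin n,
          (match M i with
            | Step.U => (X 0 : MvPolynomial (Fin 2) ℤ)
            | Step.L => X 0 + geo (X 1 : MvPolynomial (Fin 2) ℤ) (hsum M (i : ℕ))
            | Step.D => geo (X 1 : MvPolynomial (Fin 2) ℤ) (hsum M (i : ℕ))) := by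
  rw [S5.main, ← S5.Phi_delta, S5.Phi_eq_Psi, S5.Psi_delta]
  apply Finset.sum_congr rfl
  intro M _
  apply Finset.prod_congr rfl
  intro i _
  cases M i <;> rfl
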